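/- Let d ≥ 2 and let A, B ⊆ ℤ^d be finite, nonempty, connected sets with d(A,B) > 1. Then exactly one of the following holds: (i) A ⊆ fill(B) and d(fill(A),B) > 1; (ii) B ⊆ fill(A) and d(fill(B),A) > 1; (iii) d(fill(A),fill(B)) > 1. -/

import Mathlib

/-- Points of `ℤ^d`. -/
abbrev Pt (d : ℕ) := Fin d → ℤ

namespace RI

variable {d : ℕ}

/-- `l¹` distance between two points (ℕ-valued). -/
def n1 (x y : Pt d) : ℕ := ∑ j, (x j - y j).natAbs

/-- `l∞` distance between two points (ℕ-valued). -/
def ninf (x y : Pt d) : ℕ := Finset.univ.sup fun j => (x j - y j).natAbs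

/-- nearest-neighbor adjacency: `‖x - y‖₁ = 1` -/
def adj (x y : Pt d) : Prop := n1 x y = 1

/-- `*`-adjacency: `‖x - y‖_∞ = 1` -/
def adjStar (x y : Pt d) : Prop := ninf x y = 1

/-- `τ` is a nearest-neighbor path of length `N`. -/
def IsPath (τ : ℕ → Pt d) (N : ℕ) : Prop := ∀ l < N, adj (τ l) (τ (l + 1))

/-- the range of a path of length `N` -/
def pathRange (τ : ℕ → Pt d) (N : ℕ) : Set (Pt d) := τ '' {l | l ≤ N}

/-- `x` and `y` are joined by a nearest-neighbor path all of whose points lie in `U`. -/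
def ConnIn (U : Set (Pt d)) (x y : Pt d) : Prop :=
  ∃ τ N, IsPath τ N ∧ τ 0 = x ∧ τ N = y ∧ ∀ l ≤ N, τ l ∈ U

/-- a set is connected: any two of its points are joined by a path inside it -/
def ConnSet (A : Set (Pt d)) : Prop := ∀ x ∈ A, ∀ y ∈ A, ConnIn A x y

/-- the connected component of `U` containing `x` -/
def comp (U : Set (Pt d)) (x : Pt d) : Set (Pt d) := {y | ConnIn U x y}

/-- the (outer) boundary `∂K` -/
def bd (K : Set (Pt d)) : Set (Pt d) := {x | x ∉ K ∧ ∃ y ∈ K, adj x y}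

/-- the `*`-boundary `∂*K` -/
def bdStar (K : Set (Pt d)) : Set (Pt d) := {x | x ∉ K ∧ ∃ y ∈ K, adjStar x y}

/-- the interior boundary `∂_int K` -/
def intBd (K : Set (Pt d)) : Set (Pt d) := {x | x ∈ K ∧ ∃ y, y ∉ K ∧ adj x y}

/-- the `l∞` diameter of a set, valued in `ℕ∞` -/
noncomputable def diam (K : Set (Pt d)) : ℕ∞ := ⨆ x ∈ K, ⨆ y ∈ K, (ninf x y : ℕ∞)

/-- the `l¹` distance between `K` and `K'` exceeds `1` -/
def far1 (K K' : Set (Pt d)) : Prop := ∀ x ∈ K, ∀ y ∈ K', 1 < n1 x y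

/-- the `l∞` distance between `K` and `K'` exceeds `1` -/
def farInf (K K' : Set (Pt d)) : Prop := ∀ x ∈ K, ∀ y ∈ K', 1 < ninf x y

/-- `d_∞(K, K') ≤ r` -/
def dInfLE (K K' : Set (Pt d)) (r : ℕ) : Prop := ∃ x ∈ K, ∃ y ∈ K', ninf x y ≤ r

/-- `fill A`: the set of points every connected set around which inside `Aᶜ` is finite;
for `d ≥ 2` and finite `A` this is exactly the complement of the unique infinite
connected component of `Aᶜ`. -/
def fill (A : Set (Pt d)) : Set (Pt d) :=
  {z | ∀ S : Set (Pt d), z ∈ S → S ⊆ Aᶜ → ConnSet S → S.Finite}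

/-- `A₁` and `A₂` are separated by `𝒰` in `B`: `d(A₁,A₂) > 1` and every path in `B`
joining `∂A₁` to `∂A₂` meets `𝒰`. -/
def SeparatedBy (A₁ A₂ 𝒰 B : Set (Pt d)) : Prop :=
  far1 A₁ A₂ ∧
  ∀ τ N, IsPath τ N → (∀ l ≤ N, τ l ∈ B) → τ 0 ∈ bd A₁ → τ N ∈ bd A₂ →
    ∃ l ≤ N, τ l ∈ 𝒰

/-- the scales `L_κ = L₀ (80 L)^κ` -/
def Lscale (L L₀ κ : ℕ) : ℕ := L₀ * (80 * L) ^ κ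

/-- the box `C_{(κ,i)} = (i L_κ + [0, L_κ)^d) ∩ ℤ^d` -/
def boxC (L L₀ κ : ℕ) (i : Pt d) : Set (Pt d) :=
  {x | ∀ j, i j * (Lscale L L₀ κ : ℤ) ≤ x j ∧
    x j < i j * (Lscale L L₀ κ : ℤ) + (Lscale L L₀ κ : ℤ)}

/-- the neighborhood `C_{(κ,i)}^l = ⋃_{‖j‖_∞ < l} C_{(κ, i+j)}` -/
def boxCl (L L₀ κ : ℕ) (i : Pt d) (l : ℕ) : Set (Pt d) :=
  ⋃ j ∈ {j : Pt d | ∀ t, (j t).natAbs < l}, boxC L L₀ κ (i + j)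

/-- the separation event `χ_{(κ,i)}(𝒰) = 1`: there are connected sets
`A₁, A₂ ⊆ C_{(κ,i)}^2` of diameter at least `L_κ / 2` separated by `𝒰` in `C_{(κ,i)}^3` -/
def chi (L L₀ κ : ℕ) (i : Pt d) (𝒰 : Set (Pt d)) : Prop :=
  ∃ A₁ A₂ : Set (Pt d), A₁ ⊆ boxCl L L₀ κ i 2 ∧ A₂ ⊆ boxCl L L₀ κ i 2 ∧
    ConnSet A₁ ∧ ConnSet A₂ ∧
    (Lscale L L₀ κ : ℕ∞) ≤ 2 * diam A₁ ∧ (Lscale L L₀ κ : ℕ∞) ≤ 2 * diam A₂ ∧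
    SeparatedBy A₁ A₂ 𝒰 (boxCl L L₀ κ i 3)

/-- the centered boxes `C^l = [-(l-1)L₀, l L₀)^d ∩ ℤ^d` -/
def boxCen (L₀ l : ℕ) : Set (Pt d) :=
  {x | ∀ j, -(((l : ℤ) - 1) * (L₀ : ℤ)) ≤ x j ∧ x j < (l : ℤ) * (L₀ : ℤ)}

/-- the separation event `χ(𝒰) = 1` for the centered boxes -/
def chi0 (L₀ : ℕ) (𝒰 : Set (Pt d)) : Prop :=
  ∃ A₁ A₂ : Set (Pt d), A₁ ⊆ boxCen L₀ 2 ∧ A₂ ⊆ boxCen L₀ 2 ∧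
    ConnSet A₁ ∧ ConnSet A₂ ∧
    (L₀ : ℕ∞) ≤ 2 * diam A₁ ∧ (L₀ : ℕ∞) ≤ 2 * diam A₂ ∧
    SeparatedBy A₁ A₂ 𝒰 (boxCen L₀ 3)

/-- `A` is `h`-avoidable in `C`: every path in `C` with endpoints outside `A` can be
modified, within `l∞` distance `h` of its range and through `Range(τ) ∪ ∂*A`,
into a path with the same endpoints avoiding `A`. -/
def Avoidable (h : ℝ) (A C : Set (Pt d)) : Prop :=
  ∀ τ N, IsPath τ N → (∀ l ≤ N, τ l ∈ C) → τ 0 ∉ A → τ N ∉ A →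
    ∃ τ' N', IsPath τ' N' ∧ τ' 0 = τ 0 ∧ τ' N' = τ N ∧
      (∀ l ≤ N', τ' l ∉ A) ∧
      (∀ l ≤ N', (∃ k ≤ N, (ninf (τ' l) (τ k) : ℝ) ≤ h) ∧
        (τ' l ∈ pathRange τ N ∨ τ' l ∈ bdStar A))

/-- a doubly infinite transient nearest-neighbor trajectory -/
def IsTraj (w : ℤ → Pt d) : Prop :=
  (∀ l : ℤ, adj (w l) (w (l + 1))) ∧
  Filter.Tendsto (fun l : ℤ => n1 (w l) 0) Filter.cofinite Filter.atTop

/-- `k` is a cut-time of `w`: `d_∞({w(l) : l < k}, {w(l) : l > k}) > 1` -/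
def CutTime (w : ℤ → Pt d) (k : ℤ) : Prop :=
  ∀ l, l < k → ∀ l', k < l' → 1 < ninf (w l) (w l')

/-- the `j`-th sausage `𝒰_j = {w(l) : n_j < l < n_{j+1}}` -/
def sausage (w : ℤ → Pt d) (n : ℕ → ℤ) (j : ℕ) : Set (Pt d) :=
  w '' {l | n j < l ∧ l < n (j + 1)}

/-- boxes: products of integer intervals -/
def IsBox (B : Set (Pt d)) : Prop :=
  ∃ a b : Pt d, B = {x | ∀ j, a j ≤ x j ∧ x j ≤ b j}

/-- the smallest box containing `K` -/
def sbox (K : Set (Pt d)) : Set (Pt d) := ⋂₀ {B | IsBox B ∧ K ⊆ B}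

/-- the closed `l∞` ball `B(x, r)` -/
def ball (x : Pt d) (r : ℕ) : Set (Pt d) := {y | ninf x y ≤ r}

/-- a skeleton: a set of indices at the finest scale satisfying the Wiener-type
spacing conditions -/
def IsSkeleton (L L₀ : ℕ) (M : Finset (Pt d)) : Prop :=
  ∀ m₀ ∈ M,
    (∀ h : ℕ,
      {m : Pt d | m ∈ M ∧
        dInfLE (boxC L L₀ 0 m₀) (boxC L L₀ 0 m) (L * Lscale L L₀ (h + 1)) ∧
        ¬ dInfLE (boxC L L₀ 0 m₀) (boxC L L₀ 0 m) (L * Lscale L L₀ h)}.ncard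
        ≤ 2 ^ (h + 1)) ∧
    ∀ m ∈ M, m ≠ m₀ → ¬ dInfLE (boxC L L₀ 0 m₀) (boxC L L₀ 0 m) (L * Lscale L L₀ 0)

theorem n1_comm (x y : Pt d) : n1 x y = n1 y x := by
  unfold n1
  refine Finset.sum_congr rfl fun j _ => ?_
  omega

theorem n1_self (x : Pt d) : n1 x x = 0 := by
  simp [n1]

theorem n1_eq_zero {x y : Pt d} (h : n1 x y = 0) : x = y := by
  funext j
  have := Finset.sum_eq_zero_iff.mp h j (Finset.mem_univ j)
  omega

theorem adj.symm {x y : Pt d} (h : adj x y) : adj y x :=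
  (n1_comm y x).trans h

theorem adj_of_sub_eq_single {x y : Pt d} (j : Fin d) (s : ℤ) (hs : s.natAbs = 1)
    (h : x - y = Pi.single j s) : adj x y := by
  unfold adj n1
  rw [Finset.sum_eq_single j]
  · have := congrFun h j
    simp at this
    rw [this, hs]
  · intro k _ hk
    have := congrFun h k
    simp [hk] at this
    simp [this]
  · simp

theorem ConnIn.refl {U : Set (Pt d)} {x : Pt d} (hx : x ∈ U) : ConnIn U x x :=
  ⟨fun _ => x, 0, fun _ h => absurd h (Nat.not_lt_zero _), rfl, rfl, fun _ _ => hx⟩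

theorem ConnIn.symm {U : Set (Pt d)} {x y : Pt d} (h : ConnIn U x y) : ConnIn U y x := by
  obtain ⟨τ, N, hp, h0, hN, hU⟩ := h
  refine ⟨fun l => τ (N - l), N, fun l hl => ?_, by simpa using hN, by simpa using h0,
    fun l _ => hU _ (Nat.sub_le _ _)⟩
  have := (hp (N - (l + 1)) (by omega)).symm
  rwa [show N - (l + 1) + 1 = N - l by omega] at this

theorem ConnIn.mono {U V : Set (Pt d)} (hUV : U ⊆ V) {x y : Pt d} (h : ConnIn U x y) :
    ConnIn V x y := by
  obtain ⟨τ, N, hp, h0, hN, hU⟩ := h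
  exact ⟨τ, N, hp, h0, hN, fun l hl => hUV (hU l hl)⟩

theorem ConnIn.tail {U : Set (Pt d)} {x y z : Pt d} (h : ConnIn U x y) (hyz : adj y z)
    (hz : z ∈ U) : ConnIn U x z := by
  obtain ⟨τ, N, hp, h0, hN, hU⟩ := h
  refine ⟨fun l => if l ≤ N then τ l else z, N + 1, fun l hl => ?_, by simpa using h0,
    by simp, fun l _ => ?_⟩
  · rcases Nat.lt_succ_iff_lt_or_eq.mp hl with hl' | rfl
    · simpa [hl'.le, Nat.succ_le_of_lt hl'] using hp l hl'
    · simpa [hN] using hyz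
  · by_cases hl : l ≤ N
    · simpa [hl] using hU l hl
    · simpa [hl] using hz

theorem ConnSet.insert {S : Set (Pt d)} (hS : ConnSet S) {x y : Pt d} (hx : x ∈ S)
    (hxy : adj x y) : ConnSet (insert y S) := by
  have key : ∀ u ∈ S, ConnIn (Insert.insert y S) u y := fun u hu =>
    ((hS u hu x hx).mono (Set.subset_insert y S)).tail hxy (Set.mem_insert y S)
  rintro u (rfl | hu) v (rfl | hv)
  · exact ConnIn.refl (Set.mem_insert _ _)
  · exact (key v hv).symm
  · exact key u hu
  · exact (hS u hu v hv).mono (Set.subset_insert y S)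

theorem connSet_range {f : ℕ → Pt d} (hf : ∀ n, adj (f n) (f (n + 1))) :
    ConnSet (Set.range f) := by
  have key : ∀ m k, ConnIn (Set.range f) (f m) (f (m + k)) := fun m k =>
    ⟨fun l => f (m + l), k, fun l _ => hf (m + l), rfl, rfl, fun l _ => ⟨m + l, rfl⟩⟩
  rintro _ ⟨m, rfl⟩ _ ⟨n, rfl⟩
  rcases le_total m n with h | h
  · obtain ⟨k, rfl⟩ := Nat.exists_eq_add_of_le h
    exact key m k
  · obtain ⟨k, rfl⟩ := Nat.exists_eq_add_of_le h
    exact (key n k).symm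

theorem subset_fill (A : Set (Pt d)) : A ⊆ fill A :=
  fun _ hx _ hxS hSA _ => absurd hx (hSA hxS)

theorem notMem_fill_of_adj {A : Set (Pt d)} {x y : Pt d} (hx : x ∉ fill A) (hxy : adj x y)
    (hy : y ∉ A) : y ∉ fill A := by
  intro hyA
  refine hx fun S hxS hSA hS => ?_
  exact (hyA (insert y S) (Set.mem_insert y S) (Set.insert_subset hy hSA)
    (hS.insert hxS hxy)).subset (Set.subset_insert y S)

/-- A point of `fill A` with a neighbor outside `fill A` belongs to `A`. -/
theorem mem_of_mem_fill_of_adj {A : Set (Pt d)} {x y : Pt d} (hx : x ∈ fill A)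
    (hxy : adj x y) (hy : y ∉ fill A) : x ∈ A :=
  by_contra fun h => notMem_fill_of_adj hy hxy.symm h hx

theorem ConnSet.subset_fill_or_disjoint {A C : Set (Pt d)} (hC : ConnSet C)
    (hCA : Disjoint C A) : C ⊆ fill A ∨ Disjoint C (fill A) := by
  by_contra! h
  obtain ⟨hsub, hdis⟩ := h
  obtain ⟨x, hxC, hx⟩ := Set.not_subset.mp hsub
  obtain ⟨y, hyC, hy⟩ := Set.not_disjoint_iff.mp hdis
  obtain ⟨τ, N, hp, h0, hN, hU⟩ := hC x hxC y hyC
  have key : ∀ l ≤ N, τ l ∉ fill A := by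
    intro l
    induction l with
    | zero => intro _; rwa [h0]
    | succ l ih =>
      intro hl
      exact notMem_fill_of_adj (ih (by omega)) (hp l hl)
        (Set.disjoint_left.mp hCA (hU _ hl))
  exact key N le_rfl (hN ▸ hy)

/-- A point with a coordinate larger in absolute value than that of every point of `A`
escapes to infinity along a ray avoiding `A`. -/
theorem notMem_fill_of_coord_gt {A : Set (Pt d)} {x : Pt d} (j : Fin d)
    (h : ∀ a ∈ A, (a j).natAbs < (x j).natAbs) : x ∉ fill A := by
  obtain ⟨s, hs, hsx⟩ : ∃ s : ℤ, s.natAbs = 1 ∧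
      ∀ n : ℕ, (x j).natAbs ≤ (x j + n * s).natAbs := by
    rcases le_total 0 (x j) with hx | hx
    · exact ⟨1, rfl, fun n => by omega⟩
    · exact ⟨-1, rfl, fun n => by omega⟩
  set f : ℕ → Pt d := fun n => x + Pi.single j (n * s) with hf
  have hfj : ∀ n, f n j = x j + n * s := fun n => by simp [hf]
  have hinj : Function.Injective f := by
    intro m n hmn
    have := congrFun hmn j
    rw [hfj, hfj] at this
    have hs0 : s ≠ 0 := by rintro rfl; simp at hs
    exact_mod_cast mul_right_cancel₀ hs0 (add_left_cancel this)
  intro hx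
  refine Set.infinite_range_of_injective hinj
    (hx (Set.range f) ⟨0, by simp [hf]⟩ ?_ (connSet_range fun n => ?_))
  · rintro _ ⟨n, rfl⟩ hA
    have := h _ hA
    rw [hfj] at this
    exact absurd (hsx n) (by omega)
  · refine (adj_of_sub_eq_single j s hs ?_).symm
    simp only [hf, add_sub_add_left_eq_sub, ← Pi.single_sub]
    push_cast
    ring_nf

theorem fill_finite {A : Set (Pt d)} (hA : A.Finite) : (fill A).Finite := by
  have hbd : ∀ j : Fin d, ∃ R : ℕ, ∀ a ∈ A, (a j).natAbs ≤ R := fun j =>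
    (hA.image fun a => (a j).natAbs).bddAbove.imp fun R hR a ha =>
      hR (Set.mem_image_of_mem _ ha)
  choose R hR using hbd
  refine (Set.finite_Icc (fun j => -(R j : ℤ)) (fun j => (R j : ℤ))).subset fun x hx => ?_
  have key : ∀ j, (x j).natAbs ≤ R j := by
    intro j
    by_contra! hj
    exact notMem_fill_of_coord_gt j (fun a ha => (hR j a ha).trans_lt hj) hx
  exact ⟨fun j => by have := key j; dsimp only; omega,
    fun j => by have := key j; dsimp only; omega⟩

theorem exists_adj_notMem (hd : 0 < d) {K : Set (Pt d)} (hK : K.Finite) (hne : K.Nonempty) :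
    ∃ y ∈ K, ∃ z ∉ K, adj y z := by
  obtain ⟨y, hy, hmax⟩ := Set.exists_max_image K (fun x => x ⟨0, hd⟩) hK hne
  refine ⟨y, hy, y + Pi.single ⟨0, hd⟩ 1, fun hz => ?_,
    (adj_of_sub_eq_single ⟨0, hd⟩ 1 rfl (by simp)).symm⟩
  have := hmax _ hz
  simp at this

theorem far1.symm {K K' : Set (Pt d)} (h : far1 K K') : far1 K' K :=
  fun x hx y hy => n1_comm x y ▸ h y hy x hx

theorem far1.disjoint {K K' : Set (Pt d)} (h : far1 K K') : Disjoint K K' :=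
  Set.disjoint_left.mpr fun x hx hx' => by
    have := h x hx x hx'
    rw [n1_self] at this
    omega

theorem far1_of_disjoint_of_not_adj {K K' : Set (Pt d)} (hdis : Disjoint K K')
    (h : ∀ x ∈ K, ∀ y ∈ K', ¬ adj x y) : far1 K K' := by
  intro x hx y hy
  have h0 : n1 x y ≠ 0 := fun h0 => Set.disjoint_left.mp hdis hx (n1_eq_zero h0 ▸ hy)
  have h1 : n1 x y ≠ 1 := h x hx y hy
  omega

theorem far1.not_adj {K K' : Set (Pt d)} (h : far1 K K') {x y : Pt d} (hx : x ∈ K)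
    (hy : y ∈ K') : ¬ adj x y :=
  (h x hx y hy).ne'

theorem far1_fill_of_disjoint {A B : Set (Pt d)} (hfar : far1 A B)
    (hB : Disjoint B (fill A)) : far1 (fill A) B :=
  far1_of_disjoint_of_not_adj hB.symm fun _ hx _ hy hxy =>
    hfar.not_adj (mem_of_mem_fill_of_adj hx hxy (Set.disjoint_left.mp hB hy)) hy hxy

theorem far1_fill_fill {A B : Set (Pt d)} (hd : 0 < d) (hAf : A.Finite) (hfar : far1 A B)
    (hA : Disjoint A (fill B)) (hB : Disjoint B (fill A)) : far1 (fill A) (fill B) := by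
  have hdis : Disjoint (fill A) (fill B) := by
    by_contra hne
    obtain ⟨y, ⟨hyA, hyB⟩, z, hz, hyz⟩ := exists_adj_notMem hd
      ((fill_finite hAf).inter_of_left (fill B)) (Set.not_disjoint_iff_nonempty_inter.mp hne)
    by_cases hzA : z ∈ fill A
    · exact Set.disjoint_left.mp hB
        (mem_of_mem_fill_of_adj hyB hyz fun hzB => hz ⟨hzA, hzB⟩) hyA
    · exact Set.disjoint_left.mp hA (mem_of_mem_fill_of_adj hyA hyz hzA) hyB
  exact far1_of_disjoint_of_not_adj hdis fun x hx y hy hxy =>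
    hfar.not_adj (mem_of_mem_fill_of_adj hx hxy (Set.disjoint_right.mp hdis hy))
      (mem_of_mem_fill_of_adj hy hxy.symm (Set.disjoint_left.mp hdis hx)) hxy

theorem not_subset_fill_of_subset_fill {A B : Set (Pt d)} (hd : 0 < d) (hAf : A.Finite)
    (hBf : B.Finite) (hAne : A.Nonempty) (hAB : Disjoint A B) (hA : A ⊆ fill B) :
    ¬ B ⊆ fill A := by
  intro hB
  obtain ⟨y, hy, z, hz, hyz⟩ := exists_adj_notMem hd
    ((fill_finite hAf).union (fill_finite hBf))
    ((hAne.mono (subset_fill A)).mono Set.subset_union_left)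
  obtain ⟨hzA, hzB⟩ := not_or.mp hz
  have hyAB : y ∈ A ∧ y ∈ B := by
    rcases hy with hy | hy
    · have := mem_of_mem_fill_of_adj hy hyz hzA
      exact ⟨this, mem_of_mem_fill_of_adj (hA this) hyz hzB⟩
    · have := mem_of_mem_fill_of_adj hy hyz hzB
      exact ⟨mem_of_mem_fill_of_adj (hB this) hyz hzA, this⟩
  exact Set.disjoint_left.mp hAB hyAB.1 hyAB.2

/-- If `A` lies in `fill B`, then `B` stays away from `fill A`. -/
theorem nested_of_subset_fill {A B : Set (Pt d)} (hd : 0 < d) (hAf : A.Finite)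
    (hBf : B.Finite) (hAne : A.Nonempty) (hBc : ConnSet B) (hfar : far1 A B)
    (hA : A ⊆ fill B) :
    far1 (fill A) B ∧ ¬ B ⊆ fill A ∧ ¬ far1 (fill A) (fill B) := by
  have hB := not_subset_fill_of_subset_fill hd hAf hBf hAne hfar.disjoint hA
  have hdis := (hBc.subset_fill_or_disjoint hfar.disjoint.symm).resolve_left hB
  refine ⟨far1_fill_of_disjoint hfar hdis, hB, fun h => ?_⟩
  obtain ⟨a, ha⟩ := hAne
  exact Set.disjoint_left.mp h.disjoint (subset_fill A ha) (hA ha)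

/-- for finite, nonempty, connected `A, B` with `d(A,B) > 1`,
exactly one of the three alternatives holds. -/
theorem statement4 (d : ℕ) (hd : 2 ≤ d) (A B : Set (Pt d))
    (hAf : A.Finite) (hBf : B.Finite) (hAne : A.Nonempty) (hBne : B.Nonempty)
    (hAc : ConnSet A) (hBc : ConnSet B) (hfar : far1 A B) :
    ((A ⊆ fill B ∧ far1 (fill A) B) ∧
      ¬(B ⊆ fill A ∧ far1 (fill B) A) ∧ ¬ far1 (fill A) (fill B)) ∨
    (¬(A ⊆ fill B ∧ far1 (fill A) B) ∧
      (B ⊆ fill A ∧ far1 (fill B) A) ∧ ¬ far1 (fill A) (fill B)) ∨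
    (¬(A ⊆ fill B ∧ far1 (fill A) B) ∧
      ¬(B ⊆ fill A ∧ far1 (fill B) A) ∧ far1 (fill A) (fill B)) := by
  have hd0 : 0 < d := by omega
  rcases hAc.subset_fill_or_disjoint hfar.disjoint with hA | hA
  · obtain ⟨h₁, h₂, h₃⟩ := nested_of_subset_fill hd0 hAf hBf hAne hBc hfar hA
    exact Or.inl ⟨⟨hA, h₁⟩, fun h => h₂ h.1, h₃⟩
  have hA' : ¬ A ⊆ fill B := fun h => hAne.ne_empty (hA.eq_bot_of_le h)
  rcases hBc.subset_fill_or_disjoint hfar.disjoint.symm with hB | hB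
  · obtain ⟨h₁, -, h₃⟩ := nested_of_subset_fill hd0 hBf hAf hBne hAc hfar.symm hB
    exact Or.inr (Or.inl ⟨fun h => hA' h.1, ⟨hB, h₁⟩, fun h => h₃ h.symm⟩)
  · have hB' : ¬ B ⊆ fill A := fun h => hBne.ne_empty (hB.eq_bot_of_le h)
    exact Or.inr (Or.inr ⟨fun h => hA' h.1, fun h => hB' h.1,
      far1_fill_fill hd0 hAf hfar hA hB⟩)

end RI
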